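/- Let τ be an indeterminate, n ≥ 1, L = 2n, and 0 ≤ p ≤ n−1; set p̃ = n−1−p. Let F be the polynomial in ℤ[τ][u_1,…,u_n] given by F = ∏_{1≤ℓ≤m≤n}(1 − u_ℓ u_m) · ∏_{1≤ℓ<m≤n}(u_m − u_ℓ)(1 + τ u_m + u_ℓ u_m)(τ + u_ℓ + u_m). For an integer sequence b = (b_1,…,b_n), let ψ̄_b denote the coefficient in F of the monomial ∏_{ℓ=1}^{n} u_ℓ^{b_ℓ−1}. For ε = (ε_1,…,ε_p) ∈ {0,1}^p define b(ε) by b(ε)_ℓ = ℓ for 1 ≤ ℓ ≤ p̃+1 and b(ε)_ℓ = 2ℓ − p̃ − 1 − ε_{ℓ−p̃−1} for p̃+2 ≤ ℓ ≤ n, and for an indeterminate value t set S(L,p|t) := Σ_{ε ∈ {0,1}^p} t^{ε_1+⋯+ε_p} · ψ̄_{b(ε)}. Then, with ν = (n(n−1) − p(p+1))/2: S(L,p|τ) = τ^{ν} · T(L, p, n−p) and S(L,p|τ^{−1}) = τ^{ν} · T(L, p, n−p+1), the second equality holding in ℤ[τ, τ^{−1}]. -/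

import Mathlib

open Polynomial Finset MvPolynomial

/-- Binomial coefficient `C(a,b)` for integer arguments, equal to `0` if `b < 0` or `b > a`
    (for `a ≥ 0`). -/
def intChoose (a b : ℤ) : ℤ := if 0 ≤ b then (a.toNat.choose b.toNat : ℤ) else 0

/-- `T(L,p,k)`: the determinant of the `p × p` matrix whose `(ℓ,m)` entry (`1 ≤ ℓ, m ≤ p`) is
    `∑_{r=0}^{2p} C(ℓ+k-1, r-ℓ) C(m+L-2p-k, 2m-r) τ^{2(2m-r)}`, as a polynomial in `τ`. -/
noncomputable def Tpoly (L p k : ℤ) : Polynomial ℤ :=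
  Matrix.det (Matrix.of fun ℓ m : Fin p.toNat =>
    ∑ r ∈ Finset.range (2 * p.toNat + 1),
      Polynomial.C (intChoose ((ℓ : ℤ) + 1 + k - 1) ((r : ℤ) - ((ℓ : ℤ) + 1)) *
          intChoose (((m : ℤ) + 1) + L - 2 * p - k) (2 * ((m : ℤ) + 1) - (r : ℤ))) *
        Polynomial.X ^ (2 * (2 * ((m : ℤ) + 1) - (r : ℤ))).toNat)

/-- The polynomial `F ∈ ℤ[τ][u_1,…,u_n]` for even size `L = 2n`:
    `F = ∏_{1≤ℓ≤m≤n}(1 - u_ℓ u_m) ∏_{1≤ℓ<m≤n}(u_m - u_ℓ)(1 + τ u_m + u_ℓ u_m)(τ + u_ℓ + u_m)`. -/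
noncomputable def Feven (n : ℕ) : MvPolynomial (Fin n) (Polynomial ℤ) :=
  (∏ ℓ : Fin n, ∏ m : Fin n,
      if ℓ ≤ m then 1 - MvPolynomial.X ℓ * MvPolynomial.X m else 1) *
    ∏ ℓ : Fin n, ∏ m : Fin n,
      if ℓ < m then
        (MvPolynomial.X m - MvPolynomial.X ℓ) *
          (1 + MvPolynomial.C Polynomial.X * MvPolynomial.X m +
            MvPolynomial.X ℓ * MvPolynomial.X m) *
          (MvPolynomial.C Polynomial.X + MvPolynomial.X ℓ + MvPolynomial.X m)
      else 1

/-- `ψ̄_b`: the coefficient of the monomial `∏_ℓ u_ℓ^{e ℓ}` in `Feven n`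
    (here `e ℓ = b_ℓ - 1`). -/
noncomputable def psibarEven (n : ℕ) (e : Fin n → ℕ) : Polynomial ℤ :=
  MvPolynomial.coeff (Finsupp.equivFunOnFinite.symm e) (Feven n)

/-- The exponent vector `ℓ ↦ b(ε)_ℓ - 1` for even size: `b(ε)_ℓ = ℓ` for `1 ≤ ℓ ≤ p̃+1` and
    `b(ε)_ℓ = 2ℓ - p̃ - 1 - ε_{ℓ-p̃-1}` for `p̃+2 ≤ ℓ ≤ n`; indices here are `0`-based, and
    `εf` is the (`0`-based) sequence of `ε`-values. -/
def bEpsEven (n ptil : ℕ) (εf : ℕ → ℕ) : Fin n → ℕ := fun ℓ =>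
  if (ℓ : ℕ) < ptil + 1 then (ℓ : ℕ)
  else 2 * (ℓ : ℕ) - ptil - εf ((ℓ : ℕ) - ptil - 1)

theorem sum_sign_mul_comp_succ {α A : Type*} [CommRing A] {n : ℕ}
    (h : (Fin (n + 1) → α) → A) (x : Fin (n + 1) → α) :
    ∑ σ : Equiv.Perm (Fin (n + 1)), ((Equiv.Perm.sign σ : ℤ) : A) * h (x ∘ σ) =
      ∑ k : Fin (n + 1), (-1) ^ (k : ℕ) * ∑ σ : Equiv.Perm (Fin n),
        ((Equiv.Perm.sign σ : ℤ) : A) * h (Fin.cons (x k) (x ∘ k.succAbove ∘ σ)) := by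
  rw [Finset.univ_perm_fin_succ, ← Finset.univ_product_univ, Finset.sum_map, Finset.sum_product]
  refine Finset.sum_congr rfl fun k _ => ?_
  have key : ∀ e : Equiv.Perm (Fin n), x ∘ (Equiv.Perm.decomposeFin.symm (k, e)) =
      Fin.cons (x k) (fun j => x (Equiv.swap 0 k (e j).succ)) := by
    intro e
    funext j
    refine Fin.cases ?_ (fun j => ?_) j <;> simp
  simp only [Equiv.toEmbedding_apply, key, Equiv.Perm.decomposeFin.symm_sign]
  clear key
  refine Fin.cases ?_ (fun i => ?_) k
  · simp [Function.comp_def]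
  · rw [Finset.mul_sum]
    refine Fintype.sum_equiv (Equiv.mulLeft i.cycleRange) _ _ fun e => ?_
    have h1 : ((-1 : A) ^ (i : ℕ)) * (-1) ^ (i : ℕ) = 1 := by
      rw [← mul_pow]; simp
    have h2 : (fun j => x (Equiv.swap 0 i.succ (e j).succ)) =
        x ∘ i.succ.succAbove ∘ (Equiv.mulLeft i.cycleRange e) := by
      funext j
      simp [Fin.succAbove_cycleRange]
    rw [h2, if_neg (Fin.succ_ne_zero i)]
    simp only [Equiv.coe_mulLeft, Equiv.Perm.sign_mul, Fin.sign_cycleRange, Fin.val_succ]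
    push_cast
    linear_combination (((Equiv.Perm.sign e : ℤ) : A) *
      h (Fin.cons (x i.succ) (x ∘ i.succ.succAbove ∘ (i.cycleRange ∘ e)))) * h1

theorem prod_prod_le_comp_perm {A : Type*} [CommMonoid A] {n : ℕ} (f : Fin n → Fin n → A)
    (hf : ∀ i j, f i j = f j i) (σ : Equiv.Perm (Fin n)) :
    (∏ i, ∏ j, if i ≤ j then f (σ i) (σ j) else 1) = ∏ i, ∏ j, if i ≤ j then f i j else 1 := by
  rw [← Fintype.prod_prod_type' (f := fun i j => if i ≤ j then f (σ i) (σ j) else 1),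
    ← Fintype.prod_prod_type' (f := fun i j => if i ≤ j then f i j else 1),
    ← Finset.prod_filter, ← Finset.prod_filter]
  refine Finset.prod_bij' (fun q _ => (min (σ q.1) (σ q.2), max (σ q.1) (σ q.2)))
    (fun q _ => (min (σ.symm q.1) (σ.symm q.2), max (σ.symm q.1) (σ.symm q.2))) ?_ ?_ ?_ ?_ ?_
  · simp
  · simp
  · rintro ⟨i, j⟩ h
    simp only [Finset.mem_filter, Finset.mem_univ, true_and] at h
    rcases le_total (σ i) (σ j) with h' | h' <;> simp [h', h]
  · rintro ⟨i, j⟩ h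
    simp only [Finset.mem_filter, Finset.mem_univ, true_and] at h
    rcases le_total (σ.symm i) (σ.symm j) with h' | h' <;> simp [h', h]
  · rintro ⟨i, j⟩ h
    rcases le_total (σ i) (σ j) with h' | h' <;> simp [h', hf]

/-- The product of `1 - x_i x_j` over `i ≤ j`. -/
def pairSymFactor {A : Type*} [CommRing A] {n : ℕ} (x : Fin n → A) : A :=
  ∏ i, ∏ j, if i ≤ j then 1 - x i * x j else 1

/-- The product of `1 + τ x_j + x_i x_j` over `i < j`. -/
def pairFactor {A : Type*} [CommRing A] (τ : A) {n : ℕ} (x : Fin n → A) : A :=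
  ∏ i, ∏ j, if i < j then 1 + τ * x j + x i * x j else 1

theorem pairSymFactor_comp_perm {A : Type*} [CommRing A] {n : ℕ} (x : Fin n → A)
    (σ : Equiv.Perm (Fin n)) : pairSymFactor (x ∘ σ) = pairSymFactor x :=
  prod_prod_le_comp_perm (fun i j => 1 - x i * x j) (fun i j => by ring) σ

theorem pairSymFactor_cons {A : Type*} [CommRing A] {n : ℕ} (a : A) (x : Fin n → A) :
    pairSymFactor (Fin.cons a x : Fin (n + 1) → A) =
      (1 - a ^ 2) * (∏ j, (1 - a * x j)) * pairSymFactor x := by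
  simp [pairSymFactor, Fin.prod_univ_succ, sq]

theorem pairFactor_cons {A : Type*} [CommRing A] (τ : A) {n : ℕ} (a : A) (x : Fin n → A) :
    pairFactor τ (Fin.cons a x : Fin (n + 1) → A) =
      (∏ j, (1 + τ * x j + a * x j)) * pairFactor τ x := by
  simp [pairFactor, Fin.prod_univ_succ]

theorem cons_comp_succAbove {α : Type*} {n : ℕ} (x : Fin (n + 1) → α) (k : Fin (n + 1)) :
    (Fin.cons (x k) (x ∘ k.succAbove) : Fin (n + 1) → α) = x ∘ k.cycleRange.symm := by
  funext j
  refine Fin.cases ?_ (fun j => ?_) j <;> simp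

theorem pairSymFactor_succAbove {A : Type*} [CommRing A] {n : ℕ} (x : Fin (n + 1) → A)
    (k : Fin (n + 1)) :
    pairSymFactor x = (1 - x k ^ 2) * (∏ j, (1 - x k * x (k.succAbove j))) *
      pairSymFactor (x ∘ k.succAbove) := by
  rw [← pairSymFactor_comp_perm x k.cycleRange.symm, ← cons_comp_succAbove, pairSymFactor_cons]
  rfl

/-- Adding a combination of the other columns to the last one and expanding along it. -/
theorem det_eq_sum_of_last_col {A : Type*} [CommRing A] {n : ℕ} (φ : Fin (n + 1) → ℕ → A)
    (r : ℕ → A) (hr : r n = 1) :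
    (Matrix.of fun i j : Fin (n + 1) => φ i j).det =
      ∑ k : Fin (n + 1), (-1) ^ (k + n : ℕ) * (∑ j ∈ range (n + 1), r j * φ k j) *
        (Matrix.of fun i j : Fin n => φ (k.succAbove i) j).det := by
  have := Matrix.det_updateCol_sum (Matrix.of fun i j : Fin (n + 1) => φ i j) (Fin.last n)
    (fun j => r j)
  simp only [Fin.val_last, hr, one_smul] at this
  rw [← this, Matrix.det_succ_column _ (Fin.last n)]
  refine Finset.sum_congr rfl fun k _ => ?_
  congr 2
  · simp [Finset.sum_range]
  · ext i j
    simp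

theorem exists_divided_difference {K : Type*} [Field K] {n : ℕ} (P : K[X]) (hP : P.Monic)
    (hdeg : P.natDegree = n + 1) :
    ∃ r : ℕ → K, r n = 1 ∧ ∀ t, (1 + t) * ∑ j ∈ range (n + 1), r j * t ^ j =
      P.eval t - P.eval (-1) := by
  have hQ : (P /ₘ (Polynomial.X - Polynomial.C (-1))).natDegree = n := by
    rw [Polynomial.natDegree_divByMonic _ (Polynomial.monic_X_sub_C _), hdeg,
      Polynomial.natDegree_X_sub_C, Nat.add_sub_cancel]
  refine ⟨(P /ₘ (Polynomial.X - Polynomial.C (-1))).coeff, ?_, fun t => ?_⟩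
  · have h := Polynomial.leadingCoeff_divByMonic_X_sub_C P
      (by rw [Polynomial.degree_eq_natDegree hP.ne_zero, hdeg]; norm_cast) (-1)
    rw [hP.leadingCoeff, Polynomial.leadingCoeff, hQ] at h
    exact h
  · rw [← Polynomial.eval_eq_sum_range' (by omega)]
    have h := congrArg (Polynomial.eval t)
      (Polynomial.modByMonic_add_div P (Polynomial.X - Polynomial.C (-1)))
    rw [Polynomial.modByMonic_X_sub_C_eq_C_eval] at h
    simp only [Polynomial.eval_add, Polynomial.eval_mul, Polynomial.eval_sub, Polynomial.eval_X,
      Polynomial.eval_C] at h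
    linear_combination h

/-- Entries of the determinant that antisymmetrizes `invWeight`: the difference of
    `t ↦ t (t² + τ t)^j` at `t⁻¹` and `t`. -/
def flipEntry {K : Type*} [Field K] (τ t : K) (j : ℕ) : K :=
  t⁻¹ * (t⁻¹ ^ 2 + τ * t⁻¹) ^ j - t * (t ^ 2 + τ * t) ^ j

theorem exists_flipEntry_combination {K : Type*} [Field K] (τ : K) {n : ℕ} (x : Fin (n + 1) → K)
    (hx : ∀ i, x i ≠ 0) (hq : ∀ i, 1 + τ * x i + x i ^ 2 ≠ 0) :
    ∃ r : ℕ → K, r n = 1 ∧ ∀ k : Fin (n + 1),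
      ∑ j ∈ range (n + 1), r j * flipEntry τ (x k) j =
        (-1) ^ n * ((1 - x k ^ 2) * (x k)⁻¹ * ∏ j : Fin n, ((1 - x k * x (k.succAbove j)) *
          ((x (k.succAbove j))⁻¹ ^ 2 *
            (1 + τ * x (k.succAbove j) + x k * x (k.succAbove j))))) := by
  let f : K → K := fun t => t⁻¹ ^ 2 + τ * t⁻¹
  obtain ⟨r, hr, hP⟩ := exists_divided_difference (n := n)
    (∏ i, (Polynomial.X - Polynomial.C (f (x i)))) (Polynomial.monic_prod_X_sub_C _ _)
    (by simp)
  refine ⟨r, hr, fun k => ?_⟩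
  have h1 := hP (f (x k))
  have h2 := hP (x k ^ 2 + τ * x k)
  simp only [Polynomial.eval_prod, Polynomial.eval_sub, Polynomial.eval_X,
    Polynomial.eval_C] at h1 h2
  rw [Finset.prod_eq_zero (Finset.mem_univ k) (sub_self _)] at h1
  rw [Fin.prod_univ_succAbove _ k] at h2
  have h3 : ∏ j : Fin n, (x k ^ 2 + τ * x k - f (x (k.succAbove j))) =
      (-1) ^ n * ∏ j : Fin n, ((1 - x k * x (k.succAbove j)) *
          ((x (k.succAbove j))⁻¹ ^ 2 *
            (1 + τ * x (k.succAbove j) + x k * x (k.succAbove j)))) := by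
    have : ((-1 : K)) ^ n = ∏ j : Fin n, (-1) := by simp
    rw [this, ← Finset.prod_mul_distrib]
    refine Finset.prod_congr rfl fun j _ => ?_
    have := hx (k.succAbove j)
    simp only [f]
    field_simp
    ring
  rw [h3] at h2
  have h4 : ∑ j ∈ range (n + 1), r j * flipEntry τ (x k) j =
      (x k)⁻¹ * ∑ j ∈ range (n + 1), r j * f (x k) ^ j -
      x k * ∑ j ∈ range (n + 1), r j * (x k ^ 2 + τ * x k) ^ j := by
    rw [Finset.mul_sum, Finset.mul_sum, ← Finset.sum_sub_distrib]
    refine Finset.sum_congr rfl fun j _ => ?_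
    simp only [flipEntry, f]
    ring
  rw [h4]
  refine mul_left_cancel₀ (hq k) ?_
  have hf : x k ^ 2 * (1 + f (x k)) = 1 + τ * x k + x k ^ 2 := by
    have := hx k
    simp only [f]
    field_simp
    ring
  have hfg : x k * (x k ^ 2 + τ * x k - f (x k)) =
      - ((1 + τ * x k + x k ^ 2) * ((1 - x k ^ 2) * (x k)⁻¹)) := by
    have := hx k
    simp only [f]
    field_simp
    ring
  have hxx : x k * (x k)⁻¹ = 1 := mul_inv_cancel₀ (hx k)
  set Q := ∏ j : Fin n, ((1 - x k * x (k.succAbove j)) *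
          ((x (k.succAbove j))⁻¹ ^ 2 *
            (1 + τ * x (k.succAbove j) + x k * x (k.succAbove j))))
  set s₁ := ∑ j ∈ range (n + 1), r j * f (x k) ^ j
  set s₂ := ∑ j ∈ range (n + 1), r j * (x k ^ 2 + τ * x k) ^ j
  linear_combination x k * h1 - x k * h2 - (x k)⁻¹ * s₁ * hf + x k * (1 + f (x k)) * s₁ * hxx
    - (-1) ^ n * Q * hfg

/-- `pairFactor` divided by the staircase monomial `∏ x_i^(2i+1)`. -/
def invWeight {K : Type*} [Field K] (τ : K) {n : ℕ} (x : Fin n → K) : K :=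
  (∏ i, (x i)⁻¹ ^ (2 * (i : ℕ) + 1)) * pairFactor τ x

theorem invWeight_cons {K : Type*} [Field K] (τ : K) {n : ℕ} (a : K) (x : Fin n → K) :
    invWeight τ (Fin.cons a x : Fin (n + 1) → K) =
      a⁻¹ * (∏ j, ((x j)⁻¹ ^ 2 * (1 + τ * x j + a * x j))) * invWeight τ x := by
  simp only [invWeight, pairFactor_cons, Fin.prod_univ_succ, Fin.cons_zero, Fin.cons_succ,
    Fin.val_succ, Fin.val_zero, Finset.prod_mul_distrib]
  have : ∏ i : Fin n, (x i)⁻¹ ^ (2 * ((i : ℕ) + 1) + 1) =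
      (∏ i, (x i)⁻¹ ^ 2) * ∏ i : Fin n, (x i)⁻¹ ^ (2 * (i : ℕ) + 1) := by
    rw [← Finset.prod_mul_distrib]
    exact Finset.prod_congr rfl fun i _ => by ring
  rw [this]
  ring

theorem pairSymFactor_mul_sum_sign_invWeight {K : Type*} [Field K] (τ : K) {n : ℕ}
    (x : Fin n → K) (hx : ∀ i, x i ≠ 0) (hq : ∀ i, 1 + τ * x i + x i ^ 2 ≠ 0) :
    pairSymFactor x * ∑ σ : Equiv.Perm (Fin n),
      ((Equiv.Perm.sign σ : ℤ) : K) * invWeight τ (x ∘ σ) =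
    (Matrix.of fun i j : Fin n => flipEntry τ (x i) j).det := by
  induction n with
  | zero => simp [pairSymFactor, invWeight, pairFactor]
  | succ n ih =>
    obtain ⟨r, hr, hsum⟩ := exists_flipEntry_combination τ x hx hq
    rw [det_eq_sum_of_last_col (fun i j => flipEntry τ (x i) j) r hr, sum_sign_mul_comp_succ,
      Finset.mul_sum]
    refine Finset.sum_congr rfl fun k _ => ?_
    have ihk := ih (x ∘ k.succAbove) (fun i => hx _) (fun i => hq _)
    simp only [Function.comp_apply] at ihk
    rw [hsum, ← ihk, pairSymFactor_succAbove x k]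
    have h : ∀ σ : Equiv.Perm (Fin n),
        invWeight τ (Fin.cons (x k) (x ∘ k.succAbove ∘ σ) : Fin (n + 1) → K) =
        (x k)⁻¹ * (∏ j, ((x (k.succAbove j))⁻¹ ^ 2 *
          (1 + τ * x (k.succAbove j) + x k * x (k.succAbove j)))) *
          invWeight τ ((x ∘ k.succAbove) ∘ σ) := by
      intro σ
      rw [invWeight_cons]
      congr 2
      exact Equiv.prod_comp σ (fun j => (x (k.succAbove j))⁻¹ ^ 2 *
          (1 + τ * x (k.succAbove j) + x k * x (k.succAbove j)))
    simp only [h, mul_left_comm _ ((x k)⁻¹ * _) (invWeight τ _), ← Finset.mul_sum]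
    have h1 : ((-1 : K)) ^ n * (-1) ^ n = 1 := by
      rw [← mul_pow]; simp
    rw [Finset.prod_mul_distrib (f := fun j => 1 - x k * x (k.succAbove j)), pow_add]
    generalize (∏ j, ((x (k.succAbove j))⁻¹ ^ 2 *
      (1 + τ * x (k.succAbove j) + x k * x (k.succAbove j)))) = Q
    generalize (∏ j, (1 - x k * x (k.succAbove j))) = Q'
    generalize (∑ σ : Equiv.Perm (Fin n),
      ((Equiv.Perm.sign σ : ℤ) : K) * invWeight τ ((x ∘ k.succAbove) ∘ σ)) = s
    linear_combination (-((-1 : K) ^ (k : ℕ) * (1 - x k ^ 2) * (x k)⁻¹ * Q * Q' *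
      pairSymFactor (x ∘ k.succAbove) * s)) * h1

/-- The denominator-free version of `invWeight`, obtained by multiplying by `∏ x_i^(2n-1)`. -/
def numWeight {A : Type*} [CommRing A] (τ : A) {n : ℕ} (x : Fin n → A) : A :=
  (∏ i, x i ^ (2 * (n - 1 - (i : ℕ)))) * pairFactor τ x

theorem map_pairFactor {A B : Type*} [CommRing A] [CommRing B] (φ : A →+* B) (τ : A) {n : ℕ}
    (x : Fin n → A) : φ (pairFactor τ x) = pairFactor (φ τ) (φ ∘ x) := by
  simp [pairFactor, map_prod, apply_ite φ]

theorem map_pairSymFactor {A B : Type*} [CommRing A] [CommRing B] (φ : A →+* B) {n : ℕ}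
    (x : Fin n → A) : φ (pairSymFactor x) = pairSymFactor (φ ∘ x) := by
  simp [pairSymFactor, map_prod, apply_ite φ]

theorem map_numWeight {A B : Type*} [CommRing A] [CommRing B] (φ : A →+* B) (τ : A) {n : ℕ}
    (x : Fin n → A) : φ (numWeight τ x) = numWeight (φ τ) (φ ∘ x) := by
  simp [numWeight, map_prod, map_pairFactor]

theorem numWeight_eq_mul_invWeight {K : Type*} [Field K] (τ : K) {n : ℕ}
    (x : Fin n → K) (hx : ∀ i, x i ≠ 0) :
    numWeight τ x = (∏ i, x i ^ (2 * n - 1)) * invWeight τ x := by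
  rw [numWeight, invWeight, ← mul_assoc, ← Finset.prod_mul_distrib]
  congr 1
  refine Finset.prod_congr rfl fun i _ => ?_
  have hi := i.isLt
  have h : 2 * n - 1 = 2 * (n - 1 - (i : ℕ)) + (2 * (i : ℕ) + 1) := by omega
  rw [h, pow_add, mul_assoc, ← mul_pow, mul_inv_cancel₀ (hx i), one_pow, mul_one]

theorem pairSymFactor_mul_sum_sign_numWeight {A : Type*} [CommRing A] [IsDomain A] (τ : A) {n : ℕ}
    (x : Fin n → A) (hx : ∀ i, x i ≠ 0) (hq : ∀ i, 1 + τ * x i + x i ^ 2 ≠ 0) :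
    pairSymFactor x * ∑ σ : Equiv.Perm (Fin n),
      ((Equiv.Perm.sign σ : ℤ) : A) * numWeight τ (x ∘ σ) =
    (Matrix.of fun i j : Fin n => x i ^ (2 * (n - 1 - (j : ℕ))) * (1 + τ * x i) ^ (j : ℕ) -
      x i ^ (2 * n) * (x i ^ 2 + τ * x i) ^ (j : ℕ)).det := by
  let ι := algebraMap A (FractionRing A)
  have hι : Function.Injective ι := IsFractionRing.injective A (FractionRing A)
  apply hι
  have hx' : ∀ i, (ι ∘ x) i ≠ 0 := fun i h => hx i (hι (by simpa using h))
  have key := pairSymFactor_mul_sum_sign_invWeight (ι τ) (ι ∘ x) hx' (fun i h => hq i (hι (by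
    simpa using h)))
  have h1 : ∀ σ : Equiv.Perm (Fin n), numWeight (ι τ) (ι ∘ x ∘ σ) =
      (∏ i, (ι (x i)) ^ (2 * n - 1)) * invWeight (ι τ) ((ι ∘ x) ∘ σ) := by
    intro σ
    rw [← Function.comp_assoc, numWeight_eq_mul_invWeight _ ((ι ∘ x) ∘ σ) (fun i => hx' (σ i))]
    congr 1
    exact Equiv.prod_comp σ (fun i => (ι (x i)) ^ (2 * n - 1))
  rw [map_mul, map_pairSymFactor, map_sum]
  simp only [map_mul, map_intCast, map_numWeight, h1]
  simp only [mul_left_comm _ (∏ i, (ι (x i)) ^ (2 * n - 1)), ← Finset.mul_sum]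
  rw [key, ← Matrix.det_mul_column, RingHom.map_det]
  congr 1
  ext i j
  have hj := j.isLt
  have h0 := hx' i
  have h : 2 * n - 1 = 2 * (n - 1 - (j : ℕ)) + 2 * (j : ℕ) + 1 := by omega
  have h' : 2 * n = 2 * (n - 1 - (j : ℕ)) + 2 * (j : ℕ) + 2 := by omega
  simp only [RingHom.mapMatrix_apply, Matrix.map_apply, Matrix.of_apply, flipEntry,
    Function.comp_apply, map_sub, map_mul, map_pow, map_add, map_one] at h0 ⊢
  rw [h, h']
  generalize n - 1 - (j : ℕ) = d
  generalize ι (x i) = t at *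
  have h2 : t⁻¹ ^ 2 + ι τ * t⁻¹ = t⁻¹ ^ 2 * (1 + ι τ * t) := by
    field_simp
  have h3 : (t * t⁻¹) = 1 := mul_inv_cancel₀ h0
  rw [h2, mul_pow]
  have h4 : t ^ (2 * d + 2 * (j : ℕ) + 1) * (t⁻¹ * ((t⁻¹ ^ 2) ^ (j : ℕ))) = t ^ (2 * d) := by
    calc _ = t ^ (2 * d) * (t * t⁻¹) ^ (2 * (j : ℕ) + 1) := by ring
      _ = _ := by rw [h3, one_pow, mul_one]
  linear_combination (1 + ι τ * t) ^ (j : ℕ) * h4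

theorem coeff_eq_zero_of_mem_span_X_pow {R : Type*} [CommRing R] {n N : ℕ}
    {f : MvPolynomial (Fin n) R} {e : Fin n →₀ ℕ} (he : ∀ i, e i < N)
    (hf : f ∈ Ideal.span (Set.range fun i : Fin n =>
      (MvPolynomial.X i : MvPolynomial (Fin n) R) ^ N)) : coeff e f = 0 := by
  have h : (Set.range fun i : Fin n => (MvPolynomial.X i : MvPolynomial (Fin n) R) ^ N) =
      (fun s => MvPolynomial.monomial s (1 : R)) '' Set.range fun i => Finsupp.single i N := by
    ext f
    simp [MvPolynomial.X_pow_eq_monomial]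
  rw [h, mem_ideal_span_monomial_image] at hf
  by_contra hc
  obtain ⟨s, ⟨i, rfl⟩, hle⟩ := hf e (by simpa [MvPolynomial.mem_support_iff] using hc)
  have := hle i
  simp at this
  exact absurd (he i) (by omega)

theorem coeff_const_mul_pairSymFactor_mul_sum {R : Type*} [CommRing R] [IsDomain R] (τ : R)
    {n : ℕ} (Φ : MvPolynomial (Fin n) R) {c : Fin n →₀ ℕ} (hc : ∀ i, c i < 2 * n) :
    coeff c (Φ * (pairSymFactor MvPolynomial.X * ∑ σ : Equiv.Perm (Fin n),
      ((Equiv.Perm.sign σ : ℤ) : MvPolynomial (Fin n) R) *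
        numWeight (MvPolynomial.C τ) (MvPolynomial.X ∘ σ))) =
    coeff c (Φ * ∑ σ : Equiv.Perm (Fin n),
      ((Equiv.Perm.sign σ : ℤ) : MvPolynomial (Fin n) R) *
        ∏ i, (MvPolynomial.X (σ i) ^ (2 * (n - 1 - (i : ℕ))) *
          (1 + MvPolynomial.C τ * MvPolynomial.X (σ i)) ^ (i : ℕ))) := by
  rw [pairSymFactor_mul_sum_sign_numWeight _ _ (fun i => MvPolynomial.X_ne_zero i), ← sub_eq_zero,
    ← coeff_sub, ← mul_sub]
  · refine coeff_eq_zero_of_mem_span_X_pow hc (Ideal.mul_mem_left _ _ ?_)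
    rw [← Ideal.Quotient.eq, RingHom.map_det]
    have h := Matrix.det_apply' (Matrix.of fun i j : Fin n =>
      (MvPolynomial.X i : MvPolynomial (Fin n) R) ^ (2 * (n - 1 - (j : ℕ))) *
        (1 + MvPolynomial.C τ * MvPolynomial.X i) ^ (j : ℕ))
    simp only [Matrix.of_apply] at h
    rw [← h, RingHom.map_det]
    congr 1
    ext i j
    simp only [RingHom.mapMatrix_apply, Matrix.map_apply, Matrix.of_apply]
    rw [Ideal.Quotient.eq, sub_sub_cancel_left]
    exact neg_mem (Ideal.mul_mem_right _ _ (Ideal.subset_span ⟨i, rfl⟩))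
  · intro i h
    have := congrArg MvPolynomial.constantCoeff h
    simp at this

theorem coeff_const_rename_perm {R : Type*} [CommRing R] {n : ℕ} (σ : Equiv.Perm (Fin n))
    (f : MvPolynomial (Fin n) R) {c : Fin n →₀ ℕ} {N : ℕ} (hc : ∀ i, c i = N) :
    coeff c (rename σ f) = coeff c f := by
  have h : c.mapDomain σ = c := by
    ext i
    rw [← Finsupp.equivMapDomain_eq_mapDomain, Finsupp.equivMapDomain_apply, hc, hc]
  conv_lhs => rw [← h]
  exact coeff_rename_mapDomain σ σ.injective f c

theorem coeff_const_mul_numWeight {R : Type*} [CommRing R] [IsDomain R] [CharZero R] (τ : R)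
    {n : ℕ} (Φ : MvPolynomial (Fin n) R)
    (hΦ : ∀ σ : Equiv.Perm (Fin n),
      rename σ Φ = ((Equiv.Perm.sign σ : ℤ) : MvPolynomial (Fin n) R) * Φ)
    {c : Fin n →₀ ℕ} (hc : ∀ i, c i = 2 * n - 1) :
    coeff c (Φ * (pairSymFactor MvPolynomial.X * numWeight (MvPolynomial.C τ) MvPolynomial.X)) =
    coeff c (Φ * ∏ i : Fin n, (MvPolynomial.X i ^ (2 * (n - 1 - (i : ℕ))) *
          (1 + MvPolynomial.C τ * MvPolynomial.X i) ^ (i : ℕ))) := by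
  have hsum : ∀ f : MvPolynomial (Fin n) R, coeff c (Φ * ∑ σ : Equiv.Perm (Fin n),
      ((Equiv.Perm.sign σ : ℤ) : MvPolynomial (Fin n) R) * rename σ f) =
      (n.factorial : R) * coeff c (Φ * f) := by
    intro f
    rw [Finset.mul_sum, MvPolynomial.coeff_sum]
    have : ∀ σ : Equiv.Perm (Fin n), coeff c (Φ * (((Equiv.Perm.sign σ : ℤ) :
        MvPolynomial (Fin n) R) * rename σ f)) = coeff c (Φ * f) := by
      intro σ
      rw [← coeff_const_rename_perm σ (Φ * f) hc, map_mul, hΦ]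
      ring_nf
    simp [this, Fintype.card_perm]
  have key := coeff_const_mul_pairSymFactor_mul_sum τ Φ (c := c)
    (fun i => by have := hc i; have := i.isLt; omega)
  have hcomp : ∀ σ : Equiv.Perm (Fin n), (rename σ : MvPolynomial (Fin n) R →ₐ[R] _).toRingHom ∘
      MvPolynomial.X = MvPolynomial.X ∘ σ := by
    intro σ
    funext i
    simp
  have h1 : (pairSymFactor MvPolynomial.X * ∑ σ : Equiv.Perm (Fin n),
      ((Equiv.Perm.sign σ : ℤ) : MvPolynomial (Fin n) R) *
        numWeight (MvPolynomial.C τ) (MvPolynomial.X ∘ σ)) =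
      ∑ σ : Equiv.Perm (Fin n), ((Equiv.Perm.sign σ : ℤ) : MvPolynomial (Fin n) R) *
        rename σ (pairSymFactor MvPolynomial.X *
          numWeight (MvPolynomial.C τ) MvPolynomial.X) := by
    rw [Finset.mul_sum]
    refine Finset.sum_congr rfl fun σ _ => ?_
    have e1 := map_pairSymFactor (rename σ : MvPolynomial (Fin n) R →ₐ[R] _).toRingHom
      MvPolynomial.X
    have e2 := map_numWeight (rename σ : MvPolynomial (Fin n) R →ₐ[R] _).toRingHom
      (MvPolynomial.C τ) MvPolynomial.X
    rw [hcomp] at e1 e2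
    rw [pairSymFactor_comp_perm] at e1
    simp only [AlgHom.toRingHom_eq_coe, RingHom.coe_coe, rename_C] at e1 e2
    rw [map_mul, e1, e2]
    ring
  have h2 : (∑ σ : Equiv.Perm (Fin n),
      ((Equiv.Perm.sign σ : ℤ) : MvPolynomial (Fin n) R) *
        ∏ i, (MvPolynomial.X (σ i) ^ (2 * (n - 1 - (i : ℕ))) *
          (1 + MvPolynomial.C τ * MvPolynomial.X (σ i)) ^ (i : ℕ))) =
      ∑ σ : Equiv.Perm (Fin n), ((Equiv.Perm.sign σ : ℤ) : MvPolynomial (Fin n) R) *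
        rename σ (∏ i : Fin n, (MvPolynomial.X i ^ (2 * (n - 1 - (i : ℕ))) *
          (1 + MvPolynomial.C τ * MvPolynomial.X i) ^ (i : ℕ))) := by
    simp [map_prod]
  rw [h1, h2, hsum, hsum] at key
  exact mul_left_cancel₀ (Nat.cast_ne_zero.mpr n.factorial_ne_zero) key

theorem coeff_mul_pairSymFactor_mul_pairFactor {R : Type*} [CommRing R] [IsDomain R] [CharZero R]
    (τ : R) {n : ℕ} (Φ : MvPolynomial (Fin n) R)
    (hΦ : ∀ σ : Equiv.Perm (Fin n),
      rename σ Φ = ((Equiv.Perm.sign σ : ℤ) : MvPolynomial (Fin n) R) * Φ)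
    {e : Fin n →₀ ℕ} (he : ∀ i, e i = 2 * (i : ℕ) + 1) :
    coeff e (Φ * (pairSymFactor MvPolynomial.X * pairFactor (MvPolynomial.C τ) MvPolynomial.X)) =
    coeff e (Φ * ∏ i : Fin n, (1 + MvPolynomial.C τ * MvPolynomial.X i) ^ (i : ℕ)) := by
  let d : Fin n →₀ ℕ := Finsupp.equivFunOnFinite.symm fun i => 2 * (n - 1 - (i : ℕ))
  have hd : (∏ i : Fin n, (MvPolynomial.X i : MvPolynomial (Fin n) R) ^ (2 * (n - 1 - (i : ℕ)))) =
      MvPolynomial.monomial d 1 := by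
    rw [MvPolynomial.monomial_eq, Finsupp.prod_fintype _ _ (fun i => pow_zero _)]
    simp [d]
  have hc : ∀ i, (d + e) i = 2 * n - 1 := by
    intro i
    have := i.isLt
    simp only [d, Finsupp.add_apply, Finsupp.equivFunOnFinite_symm_apply_apply, he]
    omega
  have key := coeff_const_mul_numWeight τ Φ hΦ hc
  rw [Finset.prod_mul_distrib, numWeight, hd] at key
  rw [mul_left_comm _ (MvPolynomial.monomial d 1), mul_left_comm _ (MvPolynomial.monomial d 1),
    mul_left_comm _ (MvPolynomial.monomial d 1), MvPolynomial.coeff_monomial_mul,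
    MvPolynomial.coeff_monomial_mul, one_mul,
    one_mul] at key
  exact key

/-- The Vandermonde product in the variables `x_i (τ + x_i)`. -/
def vanderFactor {A : Type*} [CommRing A] (τ : A) {n : ℕ} (x : Fin n → A) : A :=
  ∏ i, ∏ j, if i < j then (x j - x i) * (τ + x i + x j) else 1

theorem vanderFactor_eq_prod_Ioi {A : Type*} [CommRing A] (τ : A) {n : ℕ} (x : Fin n → A) :
    vanderFactor τ x = ∏ i, ∏ j ∈ Finset.Ioi i, ((x j - x i) * (τ + x i + x j)) := by
  refine Finset.prod_congr rfl fun i _ => ?_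
  rw [← Finset.prod_filter, Finset.filter_lt_eq_Ioi]

theorem vanderFactor_comp_perm {A : Type*} [CommRing A] (τ : A) {n : ℕ} (x : Fin n → A)
    (σ : Equiv.Perm (Fin n)) :
    vanderFactor τ (x ∘ σ) = ((Equiv.Perm.sign σ : ℤ) : A) * vanderFactor τ x := by
  rw [vanderFactor_eq_prod_Ioi, vanderFactor_eq_prod_Ioi]
  exact σ.prod_Ioi_comp_eq_sign_mul_prod (f := fun i j => (x j - x i) * (τ + x i + x j))
    (fun i j => by ring)

theorem vanderFactor_eq_det {A : Type*} [CommRing A] (τ : A) {n : ℕ} (x : Fin n → A) :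
    vanderFactor τ x = (Matrix.of fun i j : Fin n => (x j * (τ + x j)) ^ (i : ℕ)).det := by
  rw [vanderFactor_eq_prod_Ioi, ← Matrix.det_transpose]
  refine Eq.trans ?_ (Matrix.det_vandermonde fun j => x j * (τ + x j)).symm
  refine Finset.prod_congr rfl fun i _ => Finset.prod_congr rfl fun j _ => by ring

theorem map_vanderFactor {A B : Type*} [CommRing A] [CommRing B] (φ : A →+* B) (τ : A) {n : ℕ}
    (x : Fin n → A) : φ (vanderFactor τ x) = vanderFactor (φ τ) (φ ∘ x) := by
  simp [vanderFactor, map_prod, apply_ite φ]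

theorem coeff_prod_aeval_X {R : Type*} [CommRing R] {n : ℕ} (h : Fin n → R[X])
    (e : Fin n →₀ ℕ) :
    MvPolynomial.coeff e (∏ i, Polynomial.aeval (MvPolynomial.X i : MvPolynomial (Fin n) R) (h i)) =
      ∏ i, (h i).coeff (e i) := by
  induction n with
  | zero =>
    have : e = 0 := Subsingleton.elim _ _
    simp [this]
  | succ n ih =>
    have h0 : finSuccEquiv R n (Polynomial.aeval (MvPolynomial.X 0) (h 0)) =
        (h 0).map MvPolynomial.C := by
      rw [← Polynomial.aeval_algHom_apply, finSuccEquiv_X_zero, Polynomial.aeval_X_left_eq_map]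
      rfl
    have h1 : ∀ j : Fin n, finSuccEquiv R n (Polynomial.aeval (MvPolynomial.X j.succ) (h j.succ)) =
        Polynomial.C (Polynomial.aeval (MvPolynomial.X j) (h j.succ)) := by
      intro j
      rw [← Polynomial.aeval_algHom_apply, finSuccEquiv_X_succ]
      exact Polynomial.aeval_algebraMap_apply _ _ _
    rw [← Finsupp.cons_tail e, ← finSuccEquiv_coeff_coeff, map_prod, Fin.prod_univ_succ,
      Fin.prod_univ_succ, h0]
    simp only [h1]
    rw [← map_prod, Polynomial.coeff_mul_C, Polynomial.coeff_map, MvPolynomial.coeff_C_mul, ih]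
    simp [Finsupp.tail_apply]

theorem coeff_det_aeval_X {R : Type*} [CommRing R] {n : ℕ} (h : Fin n → Fin n → R[X])
    (e : Fin n →₀ ℕ) :
    MvPolynomial.coeff e (Matrix.of fun i j : Fin n =>
      Polynomial.aeval (MvPolynomial.X j : MvPolynomial (Fin n) R) (h i j)).det =
    (Matrix.of fun i j : Fin n => (h i j).coeff (e j)).det := by
  rw [Matrix.det_apply, Matrix.det_apply, MvPolynomial.coeff_sum]
  refine Finset.sum_congr rfl fun σ _ => ?_
  rw [Units.smul_def, Units.smul_def, MvPolynomial.coeff_smul]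
  congr 1
  exact coeff_prod_aeval_X (fun i => h (σ i) i) e

/-- The symmetric one-variable weight `∏ (τ + x_i)^α (1 + τ x_i)^β`. -/
def sideWeight {A : Type*} [CommRing A] (τ : A) (α β : ℕ) {n : ℕ} (x : Fin n → A) : A :=
  ∏ i, ((τ + x i) ^ α * (1 + τ * x i) ^ β)

theorem coeff_sideWeight_mul_vanderFactor {R : Type*} [CommRing R] (τ : R) (α β : ℕ) {n : ℕ}
    (e : Fin n →₀ ℕ) :
    MvPolynomial.coeff e (sideWeight (MvPolynomial.C τ) α β MvPolynomial.X *
      vanderFactor (MvPolynomial.C τ) MvPolynomial.X *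
      ∏ i : Fin n, (1 + MvPolynomial.C τ * MvPolynomial.X i) ^ (i : ℕ)) =
    (Matrix.of fun i j : Fin n => (Polynomial.X ^ (i : ℕ) *
      (Polynomial.X + Polynomial.C τ) ^ ((i : ℕ) + α) *
        (1 + Polynomial.C τ * Polynomial.X) ^ (β + (j : ℕ))).coeff (e j)).det := by
  rw [← coeff_det_aeval_X, vanderFactor_eq_det, sideWeight, mul_right_comm,
    ← Finset.prod_mul_distrib, ← Matrix.det_mul_row]
  congr 3
  ext1 i
  ext1 j
  simp only [Matrix.of_apply, map_mul, map_pow, map_add, map_one, Polynomial.aeval_X,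
    Polynomial.aeval_C]
  rw [mul_pow, pow_add, pow_add, MvPolynomial.algebraMap_eq]
  ring

theorem coeff_sideWeight_mul_pairFactors {R : Type*} [CommRing R] [IsDomain R] [CharZero R]
    (τ : R) (α β : ℕ) {n : ℕ} {e : Fin n →₀ ℕ} (he : ∀ i, e i = 2 * (i : ℕ) + 1) :
    MvPolynomial.coeff e (sideWeight (MvPolynomial.C τ) α β MvPolynomial.X *
      vanderFactor (MvPolynomial.C τ) MvPolynomial.X *
      (pairSymFactor MvPolynomial.X * pairFactor (MvPolynomial.C τ) MvPolynomial.X)) =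
    (Matrix.of fun i j : Fin n => (Polynomial.X ^ (i : ℕ) *
      (Polynomial.X + Polynomial.C τ) ^ ((i : ℕ) + α) *
        (1 + Polynomial.C τ * Polynomial.X) ^ (β + (j : ℕ))).coeff (2 * (j : ℕ) + 1)).det := by
  rw [coeff_mul_pairSymFactor_mul_pairFactor τ _ _ he, coeff_sideWeight_mul_vanderFactor]
  · simp only [he]
  · intro σ
    have h1 := map_vanderFactor (rename σ : MvPolynomial (Fin n) R →ₐ[R] _).toRingHom
      (MvPolynomial.C τ) MvPolynomial.X
    have h2 : (rename σ : MvPolynomial (Fin n) R →ₐ[R] _).toRingHom ∘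
        MvPolynomial.X = MvPolynomial.X ∘ σ := by
      funext i
      simp
    rw [h2, vanderFactor_comp_perm] at h1
    simp only [AlgHom.toRingHom_eq_coe, RingHom.coe_coe, rename_C] at h1
    have h3 : rename σ (sideWeight (MvPolynomial.C τ) α β
        (MvPolynomial.X : Fin n → MvPolynomial (Fin n) R)) =
        sideWeight (MvPolynomial.C τ) α β MvPolynomial.X := by
      simp only [sideWeight, map_prod, map_mul, map_pow, map_add, map_one, rename_C, rename_X]
      exact Equiv.prod_comp σ (fun i => (MvPolynomial.C τ + MvPolynomial.X i) ^ α *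
        (1 + MvPolynomial.C τ * (MvPolynomial.X i : MvPolynomial (Fin n) R)) ^ β)
    rw [map_mul, h1, h3]
    ring

theorem coeff_cons_zero {R : Type*} [CommRing R] {n : ℕ} (e : Fin n →₀ ℕ)
    (f : MvPolynomial (Fin (n + 1)) R) :
    MvPolynomial.coeff (e.cons 0) f = MvPolynomial.coeff e
      (MvPolynomial.aeval (Fin.cons 0 MvPolynomial.X : Fin (n + 1) → MvPolynomial (Fin n) R) f) := by
  rw [← finSuccEquiv_coeff_coeff, ← Polynomial.constantCoeff_apply]
  congr 1
  have : ((Polynomial.constantCoeff : (MvPolynomial (Fin n) R)[X] →+* MvPolynomial (Fin n) R).comp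
      ((finSuccEquiv R n : MvPolynomial (Fin (n + 1)) R →+* (MvPolynomial (Fin n) R)[X]))) =
      ((MvPolynomial.aeval (Fin.cons 0 MvPolynomial.X : Fin (n + 1) → MvPolynomial (Fin n) R) :
        MvPolynomial (Fin (n + 1)) R →ₐ[R] MvPolynomial (Fin n) R) :
          MvPolynomial (Fin (n + 1)) R →+* MvPolynomial (Fin n) R) := by
    refine MvPolynomial.ringHom_ext (fun r => ?_) (fun i => ?_)
    · simp [finSuccEquiv_apply]
    · refine Fin.cases ?_ (fun i => ?_) i
      · simp [finSuccEquiv_X_zero]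
      · simp [finSuccEquiv_X_succ]
  exact RingHom.congr_fun this f

/-- The integrand `F` of the sum rule weighted by `∏ ((τ + x_i)(1 + τ x_i))^a`. -/
def weightedFactor {A : Type*} [CommRing A] (τ : A) (a : ℕ) {n : ℕ} (x : Fin n → A) : A :=
  sideWeight τ a a x * vanderFactor τ x * (pairSymFactor x * pairFactor τ x)

theorem map_weightedFactor {A B : Type*} [CommRing A] [CommRing B] (φ : A →+* B) (τ : A) (a : ℕ)
    {n : ℕ} (x : Fin n → A) :
    φ (weightedFactor τ a x) = weightedFactor (φ τ) a (φ ∘ x) := by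
  simp [weightedFactor, sideWeight, map_prod, map_pairFactor, map_pairSymFactor, map_vanderFactor]

theorem weightedFactor_cons_zero {A : Type*} [CommRing A] (τ : A) (a : ℕ) {n : ℕ}
    (x : Fin n → A) :
    weightedFactor τ a (Fin.cons 0 x : Fin (n + 1) → A) =
      τ ^ a * ((∏ j, x j) * weightedFactor τ (a + 1) x) := by
  have h : vanderFactor τ (Fin.cons 0 x : Fin (n + 1) → A) =
      (∏ j, x j) * (∏ j, (τ + x j)) * vanderFactor τ x := by
    simp [vanderFactor, Fin.prod_univ_succ, Finset.prod_mul_distrib]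
  simp only [weightedFactor, h, pairSymFactor_cons, pairFactor_cons, sideWeight,
    Fin.prod_univ_succ, Fin.cons_zero, Fin.cons_succ, Finset.prod_mul_distrib, pow_succ]
  simp
  ring

theorem coeff_cons_zero_weightedFactor {R : Type*} [CommRing R] (τ : R) (a : ℕ) {n : ℕ}
    (e : Fin n → ℕ) :
    MvPolynomial.coeff (Finsupp.equivFunOnFinite.symm (Fin.cons 0 (fun j => e j + 1)))
      (weightedFactor (MvPolynomial.C τ) a (MvPolynomial.X : Fin (n + 1) → MvPolynomial _ R)) =
    τ ^ a * MvPolynomial.coeff (Finsupp.equivFunOnFinite.symm e)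
      (weightedFactor (MvPolynomial.C τ) (a + 1) MvPolynomial.X) := by
  have he : (Finsupp.equivFunOnFinite.symm (Fin.cons 0 (fun j => e j + 1)) : Fin (n + 1) →₀ ℕ) =
      Finsupp.cons 0 (Finsupp.equivFunOnFinite.symm (fun _ => 1) +
        Finsupp.equivFunOnFinite.symm e) := by
    ext i
    refine Fin.cases ?_ (fun i => ?_) i <;> simp [add_comm]
  have h1 := map_weightedFactor (MvPolynomial.aeval (R := R) (Fin.cons 0 MvPolynomial.X :
    Fin (n + 1) → MvPolynomial (Fin n) R)).toRingHom (MvPolynomial.C τ) a MvPolynomial.X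
  have h2 : (MvPolynomial.aeval (R := R) (Fin.cons 0 MvPolynomial.X :
      Fin (n + 1) → MvPolynomial (Fin n) R)).toRingHom ∘ MvPolynomial.X =
      Fin.cons 0 MvPolynomial.X := by
    funext i
    simp
  have h3 : ∏ j : Fin n, (MvPolynomial.X j : MvPolynomial (Fin n) R) =
      MvPolynomial.monomial (Finsupp.equivFunOnFinite.symm fun _ => 1) 1 := by
    rw [MvPolynomial.monomial_eq, Finsupp.prod_fintype _ _ (fun i => pow_zero _)]
    simp
  rw [h2, weightedFactor_cons_zero, h3] at h1
  simp only [AlgHom.toRingHom_eq_coe, RingHom.coe_coe, MvPolynomial.aeval_C,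
    MvPolynomial.algebraMap_eq] at h1
  rw [he, coeff_cons_zero, h1, ← map_pow, MvPolynomial.coeff_C_mul,
    MvPolynomial.coeff_monomial_mul, one_mul]

theorem coeff_weightedFactor_of_staircase {R : Type*} [CommRing R] (τ : R) (p d : ℕ) (a : ℕ)
    (ε : ℕ → ℕ) (hε : ∀ i, ε i ≤ 1) :
    MvPolynomial.coeff (Finsupp.equivFunOnFinite.symm fun i : Fin (p + d) =>
        if (i : ℕ) < d then (i : ℕ) else 2 * (i : ℕ) + 1 - d - ε (i - d))
      (weightedFactor (MvPolynomial.C τ) a MvPolynomial.X) =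
    τ ^ (a * d + d.choose 2) *
      MvPolynomial.coeff (Finsupp.equivFunOnFinite.symm fun i : Fin p => 2 * (i : ℕ) + 1 - ε i)
        (weightedFactor (MvPolynomial.C τ) (a + d) (MvPolynomial.X : _ → MvPolynomial _ R)) := by
  induction d generalizing a with
  | zero => simp
  | succ d ih =>
    have h : (fun i : Fin (p + d + 1) => if (i : ℕ) < d + 1 then (i : ℕ) else
        2 * (i : ℕ) + 1 - (d + 1) - ε (i - (d + 1))) =
        Fin.cons 0 (fun i : Fin (p + d) =>
          (if (i : ℕ) < d then (i : ℕ) else 2 * (i : ℕ) + 1 - d - ε (i - d)) + 1) := by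
      funext i
      refine Fin.cases (by simp) (fun i => ?_) i
      simp only [Fin.val_succ, Fin.cons_succ, Nat.add_lt_add_iff_right, Nat.add_sub_add_right]
      have := hε (i - d)
      split_ifs <;> omega
    have h' := coeff_cons_zero_weightedFactor τ a (fun i : Fin (p + d) =>
          (if (i : ℕ) < d then (i : ℕ) else 2 * (i : ℕ) + 1 - d - ε (i - d)))
    rw [← h, ih (a + 1), ← mul_assoc, ← pow_add] at h'
    refine h'.trans ?_
    rw [Nat.choose_succ_succ' d 1, Nat.choose_one_right]
    ring_nf

theorem sum_mul_coeff_sub_eq {R : Type*} [CommRing R] {p : ℕ} (t : R)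
    (f : MvPolynomial (Fin p) R) (e : Fin p → ℕ) (he : ∀ i, 1 ≤ e i) :
    ∑ ε : Fin p → Fin 2, t ^ (∑ i, (ε i : ℕ)) *
      MvPolynomial.coeff (Finsupp.equivFunOnFinite.symm fun i => e i - (ε i : ℕ)) f =
    MvPolynomial.coeff (Finsupp.equivFunOnFinite.symm e)
      ((∏ i, (1 + MvPolynomial.C t * MvPolynomial.X i)) * f) := by
  have h : ∏ i : Fin p, (1 + MvPolynomial.C t * (MvPolynomial.X i : MvPolynomial (Fin p) R)) =
      ∑ ε : Fin p → Fin 2, MvPolynomial.monomial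
        (Finsupp.equivFunOnFinite.symm fun i => (ε i : ℕ)) (t ^ (∑ i, (ε i : ℕ))) := by
    have h2 : ∀ i : Fin p, 1 + MvPolynomial.C t * (MvPolynomial.X i : MvPolynomial (Fin p) R) =
        ∑ j : Fin 2, (MvPolynomial.C t * MvPolynomial.X i) ^ (j : ℕ) := by
      intro i
      simp [Fin.sum_univ_two]
    simp only [h2]
    rw [Finset.prod_univ_sum, Fintype.piFinset_univ]
    refine Finset.sum_congr rfl fun ε _ => ?_
    rw [MvPolynomial.monomial_eq, Finsupp.prod_fintype _ _ (fun i => pow_zero _),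
      ← Finset.prod_pow_eq_pow_sum, map_prod, ← Finset.prod_mul_distrib]
    simp [mul_pow]
  rw [h, Finset.sum_mul, MvPolynomial.coeff_sum]
  refine Finset.sum_congr rfl fun ε _ => ?_
  have h3 : (Finsupp.equivFunOnFinite.symm e : Fin p →₀ ℕ) =
      Finsupp.equivFunOnFinite.symm (fun i => (ε i : ℕ)) +
        Finsupp.equivFunOnFinite.symm (fun i => e i - (ε i : ℕ)) := by
    ext i
    have := he i
    have := (ε i).isLt
    simp
    omega
  rw [h3, MvPolynomial.coeff_monomial_mul]

theorem coeff_X_pow_mul_X_add_C_pow {R : Type*} [CommRing R] (τ : R) (ℓ a s : ℕ) :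
    ((Polynomial.X : R[X]) ^ ℓ * (Polynomial.X + Polynomial.C τ) ^ a).coeff s =
      if ℓ ≤ s then τ ^ (a - (s - ℓ)) * (a.choose (s - ℓ) : R) else 0 := by
  rw [Polynomial.coeff_X_pow_mul', Polynomial.coeff_X_add_C_pow]

theorem coeff_one_add_C_mul_X_pow {R : Type*} [CommRing R] (τ : R) (N j : ℕ) :
    ((1 + Polynomial.C τ * Polynomial.X : R[X]) ^ N).coeff j = τ ^ j * (N.choose j : R) := by
  have h : (1 + Polynomial.C τ * Polynomial.X : R[X]) ^ N =
      ((1 + Polynomial.X : R[X]) ^ N).comp (Polynomial.C τ * Polynomial.X) := by simp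
  rw [h, Polynomial.comp_C_mul_X_coeff, Polynomial.coeff_one_add_X_pow, mul_comm]

theorem coeff_eq_T_mul_toLaurent {p : ℕ} (α N ℓ m : ℕ) (hm : m < p) (A B : ℤ)
    (hA : A = ((ℓ + α : ℕ) : ℤ)) (hB : B = (N : ℤ)) :
    ((Polynomial.X : (LaurentPolynomial ℤ)[X]) ^ ℓ *
        (Polynomial.X + Polynomial.C (LaurentPolynomial.T 1)) ^ (ℓ + α) *
          (1 + Polynomial.C (LaurentPolynomial.T 1) * Polynomial.X) ^ N).coeff (2 * m + 1) =
      LaurentPolynomial.T ((α : ℤ) - 1 + 2 * ℓ) * (LaurentPolynomial.T (-2 * (m : ℤ)) *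
        Polynomial.toLaurent (∑ r ∈ Finset.range (2 * p + 1),
          Polynomial.C (intChoose A ((r : ℤ) - ((ℓ : ℤ) + 1)) *
              intChoose B (2 * ((m : ℤ) + 1) - (r : ℤ))) *
            Polynomial.X ^ (2 * (2 * ((m : ℤ) + 1) - (r : ℤ))).toNat)) := by
  subst hA hB
  rw [Finset.sum_range_succ', Polynomial.coeff_mul,
    Finset.Nat.sum_antidiagonal_eq_sum_range_succ_mk]
  have h0 : intChoose ((ℓ + α : ℕ) : ℤ) (((0 : ℕ) : ℤ) - ((ℓ : ℤ) + 1)) = 0 := by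
    rw [intChoose, if_neg (by push_cast; omega)]
  rw [h0, zero_mul, Polynomial.C_0, zero_mul, add_zero,
    ← Finset.sum_subset (Finset.range_subset_range.2 (show (2 * m + 1).succ ≤ 2 * p by omega))]
  · rw [map_sum, Finset.mul_sum, Finset.mul_sum]
    refine Finset.sum_congr rfl fun s hs => ?_
    rw [Finset.mem_range] at hs
    rw [coeff_X_pow_mul_X_add_C_pow, coeff_one_add_C_mul_X_pow]
    split_ifs with h
    · have e1 : intChoose ((ℓ + α : ℕ) : ℤ) (((s + 1 : ℕ) : ℤ) - ((ℓ : ℤ) + 1)) =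
          ((ℓ + α).choose (s - ℓ) : ℤ) := by
        rw [intChoose, if_pos (by push_cast; omega)]
        congr 2
        push_cast
        omega
      have e2 : intChoose (N : ℤ) (2 * ((m : ℤ) + 1) - ((s + 1 : ℕ) : ℤ)) =
          (N.choose (2 * m + 1 - s) : ℤ) := by
        rw [intChoose, if_pos (by push_cast; omega)]
        congr 2
        push_cast
        omega
      have e3 : (2 * (2 * ((m : ℤ) + 1) - ((s + 1 : ℕ) : ℤ))).toNat = 2 * (2 * m + 1 - s) := by
        push_cast
        omega
      rw [e1, e2, e3]
      rcases lt_or_ge (ℓ + α) (s - ℓ) with h' | h'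
      · simp [Nat.choose_eq_zero_of_lt h']
      · simp only [map_mul, Polynomial.toLaurent_C, Polynomial.toLaurent_X_pow,
          LaurentPolynomial.T_pow]
        simp only [map_natCast]
        have e4 : (LaurentPolynomial.T ((α : ℤ) - 1 + 2 * ℓ) *
            (LaurentPolynomial.T (-2 * (m : ℤ)) *
              LaurentPolynomial.T ((2 * (2 * m + 1 - s) : ℕ) : ℤ)) : LaurentPolynomial ℤ) =
            LaurentPolynomial.T (((ℓ + α - (s - ℓ) : ℕ) : ℤ) * 1) *
              LaurentPolynomial.T (((2 * m + 1 - s : ℕ) : ℤ) * 1) := by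
          rw [← LaurentPolynomial.T_add, ← LaurentPolynomial.T_add, ← LaurentPolynomial.T_add]
          congr 1
          omega
        linear_combination (-((ℓ + α).choose (s - ℓ) : LaurentPolynomial ℤ) *
          (N.choose (2 * m + 1 - s) : LaurentPolynomial ℤ)) * e4
    · have e1 : intChoose ((ℓ + α : ℕ) : ℤ) (((s + 1 : ℕ) : ℤ) - ((ℓ : ℤ) + 1)) = 0 := by
        rw [intChoose, if_neg (by push_cast; omega)]
      rw [e1]
      simp only [zero_mul, map_zero, mul_zero]
  · intro s _ hs
    rw [Finset.mem_range] at hs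
    have e1 : intChoose (N : ℤ) (2 * ((m : ℤ) + 1) - ((s + 1 : ℕ) : ℤ)) = 0 := by
      rw [intChoose, if_neg (by push_cast; omega)]
    rw [e1]
    simp

theorem det_coeff_eq_T_mul_toLaurent_Tpoly (p α β : ℕ) (L k : ℤ) (hk : k = α)
    (hL : L - 2 * p - k + 1 = β) :
    (Matrix.of fun i j : Fin p =>
      ((Polynomial.X : (LaurentPolynomial ℤ)[X]) ^ (i : ℕ) *
        (Polynomial.X + Polynomial.C (LaurentPolynomial.T 1)) ^ ((i : ℕ) + α) *
          (1 + Polynomial.C (LaurentPolynomial.T 1) * Polynomial.X) ^ (β + (j : ℕ))).coeff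
            (2 * (j : ℕ) + 1)).det =
      LaurentPolynomial.T (p * ((α : ℤ) - 1)) * Polynomial.toLaurent (Tpoly L p k) := by
  have hT : Polynomial.toLaurent (Tpoly L p k) = (Matrix.of fun ℓ m : Fin p =>
      Polynomial.toLaurent (∑ r ∈ Finset.range (2 * p + 1),
        Polynomial.C (intChoose ((ℓ : ℤ) + 1 + k - 1) ((r : ℤ) - ((ℓ : ℤ) + 1)) *
            intChoose (((m : ℤ) + 1) + L - 2 * p - k) (2 * ((m : ℤ) + 1) - (r : ℤ))) *
          Polynomial.X ^ (2 * (2 * ((m : ℤ) + 1) - (r : ℤ))).toNat)).det := by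
    rw [Tpoly, RingHom.map_det]
    rfl
  have hS : LaurentPolynomial.T (p * ((α : ℤ) - 1)) =
      (∏ i : Fin p, LaurentPolynomial.T ((α : ℤ) - 1 + 2 * ((i : ℕ) : ℤ))) *
        ∏ j : Fin p, (LaurentPolynomial.T (-2 * ((j : ℕ) : ℤ)) : LaurentPolynomial ℤ) := by
    rw [← Finset.prod_mul_distrib]
    simp only [← LaurentPolynomial.T_add]
    have : ∀ i : Fin p, (α : ℤ) - 1 + 2 * ((i : ℕ) : ℤ) + -2 * ((i : ℕ) : ℤ) = α - 1 :=
      fun i => by ring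
    simp only [this, Finset.prod_const, Finset.card_univ, Fintype.card_fin,
      LaurentPolynomial.T_pow]
  rw [hT, hS, mul_assoc, ← Matrix.det_mul_row, ← Matrix.det_mul_column]
  refine congrArg Matrix.det (Matrix.ext fun i j => ?_)
  exact coeff_eq_T_mul_toLaurent α (β + j) i j j.isLt _ _ (by push_cast; omega)
    (by push_cast; omega)

instance charZero_laurentPolynomial_int : CharZero (LaurentPolynomial ℤ) :=
  charZero_of_injective_ringHom (f := (Polynomial.toLaurent : ℤ[X] →+* LaurentPolynomial ℤ))
    Polynomial.toLaurent_injective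

theorem map_Feven (n : ℕ) :
    MvPolynomial.map Polynomial.toLaurent (Feven n) =
      weightedFactor (MvPolynomial.C (LaurentPolynomial.T 1)) 0
        (MvPolynomial.X : _ → MvPolynomial (Fin n) (LaurentPolynomial ℤ)) := by
  have h : ∀ i j : Fin n, (if i < j then (MvPolynomial.X j - MvPolynomial.X i) *
      (1 + MvPolynomial.C (LaurentPolynomial.T 1) * MvPolynomial.X j +
        MvPolynomial.X i * MvPolynomial.X j) *
      (MvPolynomial.C (LaurentPolynomial.T 1) + MvPolynomial.X i + MvPolynomial.X j) else
        (1 : MvPolynomial (Fin n) (LaurentPolynomial ℤ))) =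
      (if i < j then (MvPolynomial.X j - MvPolynomial.X i) *
        (MvPolynomial.C (LaurentPolynomial.T 1) + MvPolynomial.X i + MvPolynomial.X j) else 1) *
      (if i < j then 1 + MvPolynomial.C (LaurentPolynomial.T 1) * MvPolynomial.X j +
        MvPolynomial.X i * MvPolynomial.X j else 1) := by
    intro i j
    split_ifs <;> ring
  simp only [Feven, map_mul, map_prod,
    apply_ite (MvPolynomial.map (σ := Fin n) (Polynomial.toLaurent : ℤ[X] →+* LaurentPolynomial ℤ)),
    map_sub, map_add, map_one, MvPolynomial.map_X, MvPolynomial.map_C, Polynomial.toLaurent_X, h,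
    Finset.prod_mul_distrib, weightedFactor, sideWeight, vanderFactor, pairSymFactor, pairFactor,
    pow_zero, Finset.prod_const_one]
  ring

theorem sum_mul_toLaurent_psibarEven (p d : ℕ) (t : LaurentPolynomial ℤ) :
    ∑ ε : Fin p → Fin 2, t ^ (∑ i : Fin p, (ε i : ℕ)) *
      Polynomial.toLaurent (psibarEven (p + (d + 1))
        (bEpsEven (p + (d + 1)) d fun j => if h : j < p then (ε ⟨j, h⟩ : ℕ) else 0)) =
    LaurentPolynomial.T ((d + 1).choose 2 : ℤ) *
      MvPolynomial.coeff (Finsupp.equivFunOnFinite.symm fun i : Fin p => 2 * (i : ℕ) + 1)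
        ((∏ i, (1 + MvPolynomial.C t * MvPolynomial.X i)) *
          weightedFactor (MvPolynomial.C (LaurentPolynomial.T 1)) (d + 1) MvPolynomial.X) := by
  rw [← sum_mul_coeff_sub_eq _ _ _ (fun i => by omega), Finset.mul_sum]
  refine Finset.sum_congr rfl fun ε _ => ?_
  have hb : (bEpsEven (p + (d + 1)) d fun j => if h : j < p then (ε ⟨j, h⟩ : ℕ) else 0) =
      fun i : Fin (p + (d + 1)) => if (i : ℕ) < d + 1 then (i : ℕ) else 2 * (i : ℕ) + 1 - (d + 1) -
        (fun j => if h : j < p then (ε ⟨j, h⟩ : ℕ) else 0) (i - (d + 1)) := by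
    funext i
    rw [bEpsEven]
    congr 2
    omega
  have hε : ∀ j, (fun j => if h : j < p then (ε ⟨j, h⟩ : ℕ) else 0) j ≤ 1 := by
    intro j
    dsimp only
    split_ifs with h
    · exact Nat.lt_succ_iff.1 (ε ⟨j, h⟩).isLt
    · exact zero_le_one
  rw [psibarEven, ← MvPolynomial.coeff_map, hb, map_Feven,
    coeff_weightedFactor_of_staircase _ p (d + 1) 0 _ hε, LaurentPolynomial.T_pow]
  simp only [Fin.is_lt, dite_true, Fin.eta, zero_mul, zero_add, mul_one]
  ring

theorem sum_T_mul_toLaurent_psibarEven (p d : ℕ) :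
    ∑ ε : Fin p → Fin 2, LaurentPolynomial.T (∑ i : Fin p, ((ε i : ℕ) : ℤ)) *
      Polynomial.toLaurent (psibarEven (p + (d + 1))
        (bEpsEven (p + (d + 1)) d fun j => if h : j < p then (ε ⟨j, h⟩ : ℕ) else 0)) =
    LaurentPolynomial.T (((d + 1).choose 2 : ℤ) + p * d) *
      Polynomial.toLaurent (Tpoly (2 * (p + (d + 1))) p (d + 1)) := by
  have h := sum_mul_toLaurent_psibarEven p d (LaurentPolynomial.T 1)
  have hw : (∏ i : Fin p, (1 + MvPolynomial.C (LaurentPolynomial.T 1) * MvPolynomial.X i)) *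
      weightedFactor (MvPolynomial.C (LaurentPolynomial.T 1)) (d + 1) MvPolynomial.X =
      sideWeight (MvPolynomial.C (LaurentPolynomial.T 1)) (d + 1) (d + 2) MvPolynomial.X *
        vanderFactor (MvPolynomial.C (LaurentPolynomial.T 1)) MvPolynomial.X *
        (pairSymFactor MvPolynomial.X * pairFactor (MvPolynomial.C (LaurentPolynomial.T 1))
          (MvPolynomial.X : _ → MvPolynomial (Fin p) (LaurentPolynomial ℤ))) := by
    simp only [weightedFactor, ← mul_assoc]
    congr 3
    simp only [sideWeight, ← Finset.prod_mul_distrib]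
    exact Finset.prod_congr rfl fun i _ => by ring
  rw [hw, coeff_sideWeight_mul_pairFactors _ _ _ (fun i => rfl),
    det_coeff_eq_T_mul_toLaurent_Tpoly p (d + 1) (d + 2) (2 * (p + (d + 1))) (d + 1) (by simp)
      (by push_cast; ring), ← mul_assoc, ← LaurentPolynomial.T_add] at h
  simp only [LaurentPolynomial.T_pow] at h
  have he : ((d + 1).choose 2 : ℤ) + p * d = (d + 1).choose 2 + p * (((d + 1 : ℕ) : ℤ) - 1) := by
    push_cast
    ring
  rw [he, ← h]
  refine Finset.sum_congr rfl fun ε _ => ?_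
  congr 2
  push_cast
  ring

theorem sum_T_neg_mul_toLaurent_psibarEven (p d : ℕ) :
    ∑ ε : Fin p → Fin 2, LaurentPolynomial.T (-∑ i : Fin p, ((ε i : ℕ) : ℤ)) *
      Polynomial.toLaurent (psibarEven (p + (d + 1))
        (bEpsEven (p + (d + 1)) d fun j => if h : j < p then (ε ⟨j, h⟩ : ℕ) else 0)) =
    LaurentPolynomial.T (((d + 1).choose 2 : ℤ) + p * d) *
      Polynomial.toLaurent (Tpoly (2 * (p + (d + 1))) p (d + 1 + 1)) := by
  have h := sum_mul_toLaurent_psibarEven p d (LaurentPolynomial.T (-1))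
  have hw : (∏ i : Fin p, (1 + MvPolynomial.C (LaurentPolynomial.T (-1)) * MvPolynomial.X i)) *
      weightedFactor (MvPolynomial.C (LaurentPolynomial.T 1)) (d + 1) MvPolynomial.X =
      MvPolynomial.C (LaurentPolynomial.T (-p)) *
      (sideWeight (MvPolynomial.C (LaurentPolynomial.T 1)) (d + 2) (d + 1) MvPolynomial.X *
        vanderFactor (MvPolynomial.C (LaurentPolynomial.T 1)) MvPolynomial.X *
        (pairSymFactor MvPolynomial.X * pairFactor (MvPolynomial.C (LaurentPolynomial.T 1))
          (MvPolynomial.X : _ → MvPolynomial (Fin p) (LaurentPolynomial ℤ)))) := by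
    have hT : (MvPolynomial.C (LaurentPolynomial.T (-p)) :
        MvPolynomial (Fin p) (LaurentPolynomial ℤ)) =
        ∏ _i : Fin p, MvPolynomial.C (LaurentPolynomial.T (-1)) := by
      rw [Finset.prod_const, Finset.card_univ, Fintype.card_fin, ← map_pow,
        LaurentPolynomial.T_pow]
      simp
    have hu : (MvPolynomial.C (LaurentPolynomial.T (-1)) * MvPolynomial.C (LaurentPolynomial.T 1) :
        MvPolynomial (Fin p) (LaurentPolynomial ℤ)) = 1 := by
      rw [← map_mul, ← LaurentPolynomial.T_add]
      simp
    simp only [weightedFactor, ← mul_assoc]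
    congr 3
    simp only [hT, sideWeight, ← Finset.prod_mul_distrib]
    refine Finset.prod_congr rfl fun i _ => ?_
    rw [← hu]
    ring
  rw [hw, MvPolynomial.coeff_C_mul, coeff_sideWeight_mul_pairFactors _ _ _ (fun i => rfl),
    det_coeff_eq_T_mul_toLaurent_Tpoly p (d + 2) (d + 1) (2 * (p + (d + 1))) (d + 1 + 1)
      (by push_cast; ring) (by push_cast; ring), ← mul_assoc, ← mul_assoc,
    ← LaurentPolynomial.T_add, ← LaurentPolynomial.T_add] at h
  simp only [LaurentPolynomial.T_pow] at h
  have he : ((d + 1).choose 2 : ℤ) + p * d = (d + 1).choose 2 + -p + p * (((d + 2 : ℕ) : ℤ) - 1) := by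
    push_cast
    ring
  rw [he, ← h]
  refine Finset.sum_congr rfl fun ε _ => ?_
  congr 2
  push_cast
  ring

/-- The even-size sum rule: with `L = 2n`, `0 ≤ p ≤ n-1`, `p̃ = n-1-p` and
    `ν = (n(n-1) - p(p+1))/2`, the partial sums
    `S(L,p|t) = ∑_{ε ∈ {0,1}^p} t^{ε_1+⋯+ε_p} ψ̄_{b(ε)}` satisfy
    `S(L,p|τ) = τ^ν T(L,p,n-p)` and `S(L,p|τ⁻¹) = τ^ν T(L,p,n-p+1)` in `ℤ[τ,τ⁻¹]`. -/
theorem even_size_sum_rule (n p ptil : ℕ) (hn : 1 ≤ n) (hp : p + 1 ≤ n)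
    (hptil : ptil = n - 1 - p) :
    ((∑ ε : Fin p → Fin 2,
          LaurentPolynomial.T (∑ i : Fin p, ((ε i : ℕ) : ℤ)) *
            Polynomial.toLaurent
              (psibarEven n
                (bEpsEven n ptil fun j => if h : j < p then (ε ⟨j, h⟩ : ℕ) else 0))) =
        LaurentPolynomial.T (((n : ℤ) * ((n : ℤ) - 1) - (p : ℤ) * ((p : ℤ) + 1)) / 2) *
          Polynomial.toLaurent (Tpoly (2 * (n : ℤ)) (p : ℤ) ((n : ℤ) - (p : ℤ)))) ∧
      ((∑ ε : Fin p → Fin 2,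
          LaurentPolynomial.T (-∑ i : Fin p, ((ε i : ℕ) : ℤ)) *
            Polynomial.toLaurent
              (psibarEven n
                (bEpsEven n ptil fun j => if h : j < p then (ε ⟨j, h⟩ : ℕ) else 0))) =
        LaurentPolynomial.T (((n : ℤ) * ((n : ℤ) - 1) - (p : ℤ) * ((p : ℤ) + 1)) / 2) *
          Polynomial.toLaurent (Tpoly (2 * (n : ℤ)) (p : ℤ) ((n : ℤ) - (p : ℤ) + 1))) := by
  obtain ⟨d, rfl⟩ : ∃ d, n = p + (d + 1) := ⟨n - (p + 1), by omega⟩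
  obtain rfl : ptil = d := by omega
  have hν : (((p + (ptil + 1) : ℕ) : ℤ) * (((p + (ptil + 1) : ℕ) : ℤ) - 1) -
      (p : ℤ) * ((p : ℤ) + 1)) / 2 = ((ptil + 1).choose 2 : ℤ) + p * ptil := by
    have h2 : ((ptil + 1).choose 2 : ℤ) * 2 = (ptil + 1) * ptil := by
      have := Finset.sum_range_id_mul_two (ptil + 1)
      rw [Finset.sum_range_id, ← Nat.choose_two_right, Nat.add_sub_cancel] at this
      exact_mod_cast this
    refine Int.ediv_eq_of_eq_mul_left two_ne_zero ?_
    push_cast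
    linear_combination -h2
  have hk : ((p + (ptil + 1) : ℕ) : ℤ) - p = ptil + 1 := by
    push_cast
    ring
  have hL : (2 : ℤ) * ((p + (ptil + 1) : ℕ) : ℤ) = 2 * (p + (ptil + 1)) := by
    push_cast
    ring
  rw [hν, hk, hL]
  exact ⟨sum_T_mul_toLaurent_psibarEven p ptil, sum_T_neg_mul_toLaurent_psibarEven p ptil⟩
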